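/- For the ball-shuffling problem with two bins, the optimal cost satisfies f_2(n) ≥ (1/4)·n^{4/3} − 2n for every integer n ≥ 1. -/

import Mathlib

/-- One shuffle step in the ball-shuffling problem with `t` bins:
a set `I` of bins is emptied, the new ball is added to the collected balls,
and the collected balls are redistributed among bins that are empty after the
collection (bins not in `I` that are nonempty keep their contents).
The cost is `(∑ i ∈ I, b i) + 1`. -/
def ShuffleStep (t : ℕ) (b b' : Fin t → ℕ) (c : ℕ) : Prop :=
  ∃ I : Finset (Fin t),
    c = (∑ i ∈ I, b i) + 1 ∧
    (∀ i, i ∉ I → b i ≠ 0 → b' i = b i) ∧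
    (∑ i, b' i) = (∑ i, b i) + 1

/-- An algorithm (run) for the ball-shuffling problem with `t` bins and `n` balls:
a sequence of configurations starting from all-empty bins, where the `k`-th step
is a valid shuffle of cost `c k`. -/
def IsRun (t n : ℕ) (b : ℕ → Fin t → ℕ) (c : ℕ → ℕ) : Prop :=
  (∀ i, b 0 i = 0) ∧ ∀ k, k < n → ShuffleStep t (b k) (b (k + 1)) (c k)

/-- `shuffleCost t n` is the minimum total cost of any algorithm for the
ball-shuffling problem with `n` balls and `t` bins. -/
noncomputable def shuffleCost (t n : ℕ) : ℕ :=
  sInf { s | ∃ b c, IsRun t n b c ∧ s = ∑ k ∈ Finset.range n, c k }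

/-- With two bins, a shuffle either increments one bin at the cost of its new size, or moves
every ball. -/
lemma ShuffleStep.two_bins {b b' : Fin 2 → ℕ} {c : ℕ} (h : ShuffleStep 2 b b' c) :
    b' 0 + b' 1 = b 0 + b 1 + 1 ∧
      (c = b 0 + b 1 + 1 ∨ (c = b 0 + 1 ∧ b' 0 = b 0 + 1 ∧ b' 1 = b 1) ∨
        (c = b 1 + 1 ∧ b' 1 = b 1 + 1 ∧ b' 0 = b 0)) := by
  obtain ⟨I, hc, hkeep, hsum⟩ := h
  have hI : ∑ i ∈ I, b i = ∑ i, if i ∈ I then b i else 0 := by simp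
  rw [hI, Fin.sum_univ_two] at hc
  rw [Fin.sum_univ_two, Fin.sum_univ_two] at hsum
  have h0 := hkeep 0
  have h1 := hkeep 1
  by_cases m0 : (0 : Fin 2) ∈ I <;> by_cases m1 : (1 : Fin 2) ∈ I <;>
    simp only [m0, m1, if_true, if_false, not_true_eq_false, not_false_eq_true,
      false_imp_iff, true_imp_iff] at hc h0 h1 <;> omega

lemma IsRun.sum_two_bins {n : ℕ} {b : ℕ → Fin 2 → ℕ} {c : ℕ → ℕ} (h : IsRun 2 n b c) :
    ∀ k ≤ n, b k 0 + b k 1 = k := by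
  intro k
  induction k with
  | zero => simp [h.1]
  | succ k ih =>
    intro hk
    have h1 := (h.2 k hk).two_bins.1
    have h2 := ih (by omega)
    omega

/-- The potential of a bin of size `x`: the total amount by which the costs of filling it one
ball at a time stay below the target `M`. -/
def binPotential (M x : ℕ) : ℕ := ∑ j ∈ Finset.range x, (M - 1 - j)

lemma binPotential_succ (M x : ℕ) :
    binPotential M (x + 1) = binPotential M x + (M - 1 - x) :=
  Finset.sum_range_succ _ _

lemma binPotential_mono (M : ℕ) : Monotone (binPotential M) :=
  monotone_nat_of_le_succ fun x => by rw [binPotential_succ]; omega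

lemma binPotential_of_le {M x : ℕ} (h : M ≤ x) : binPotential M x = binPotential M M := by
  induction x, h using Nat.le_induction with
  | base => rfl
  | succ x hx ih => rw [binPotential_succ, ih]; omega

lemma binPotential_le_self (M x : ℕ) : binPotential M x ≤ binPotential M M := by
  rcases le_total x M with h | h
  · exact binPotential_mono M h
  · exact (binPotential_of_le h).le

lemma binPotential_self_le (M : ℕ) : binPotential M M ≤ M ^ 2 := by
  calc binPotential M M ≤ ∑ _j ∈ Finset.range M, M := Finset.sum_le_sum fun j _ => by omega
    _ = M ^ 2 := by simp [sq]

lemma ShuffleStep.le_cost_add_binPotential {b b' : Fin 2 → ℕ} {c M : ℕ}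
    (h : ShuffleStep 2 b b' c) (hM : M ^ 2 + M ≤ b 0 + b 1) :
    M + (binPotential M (b 0) + binPotential M (b 1)) ≤
      c + (binPotential M (b' 0) + binPotential M (b' 1)) := by
  obtain ⟨hsum, hc | ⟨hc, h0, h1⟩ | ⟨hc, h1, h0⟩⟩ := h.two_bins
  · have g0 := binPotential_le_self M (b 0)
    have g1 := binPotential_le_self M (b 1)
    have gM := binPotential_self_le M
    have hsq : M ≤ M ^ 2 := Nat.le_self_pow two_ne_zero M
    rcases (show M ≤ b' 0 ∨ M ≤ b' 1 by omega) with h' | h' <;>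
      have := binPotential_of_le h' <;> omega
  · rw [h0, h1, binPotential_succ]; omega
  · rw [h0, h1, binPotential_succ]; omega

lemma IsRun.mul_le_cost_add_binPotential {n : ℕ} {b : ℕ → Fin 2 → ℕ} {c : ℕ → ℕ}
    (h : IsRun 2 n b c) (M : ℕ) :
    ∀ k ≤ n, k * M ≤ ∑ i ∈ Finset.range k, c i + (M ^ 2 + M) * M +
      (binPotential M (b k 0) + binPotential M (b k 1)) := by
  intro k
  induction k with
  | zero => simp
  | succ k ih =>
    intro hk
    rcases le_or_gt (k + 1) (M ^ 2 + M) with hkM | hkM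
    · have := Nat.mul_le_mul_right M hkM
      omega
    · have hs := h.sum_two_bins k (by omega)
      have hstep := (h.2 k hk).le_cost_add_binPotential (M := M) (by omega)
      have hih := ih (by omega)
      rw [Finset.sum_range_succ, add_mul, one_mul]
      omega

lemma IsRun.mul_le_cost {n : ℕ} {b : ℕ → Fin 2 → ℕ} {c : ℕ → ℕ} (h : IsRun 2 n b c) (M : ℕ) :
    n * M ≤ ∑ i ∈ Finset.range n, c i + M ^ 3 + 3 * M ^ 2 := by
  have h1 := h.mul_le_cost_add_binPotential M n le_rfl
  have g0 := binPotential_le_self M (b n 0)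
  have g1 := binPotential_le_self M (b n 1)
  have gM := binPotential_self_le M
  nlinarith

lemma exists_isRun_two (n : ℕ) : ∃ b c, IsRun 2 n b c := by
  refine ⟨fun k => ![k, 0], fun k => k + 1, ?_, fun k _ => ⟨{0}, ?_, ?_, ?_⟩⟩
  · intro i; fin_cases i <;> rfl
  · simp
  · intro i; fin_cases i <;> simp
  · simp [Fin.sum_univ_two]

lemma mul_le_shuffleCost_two (n M : ℕ) : n * M ≤ shuffleCost 2 n + M ^ 3 + 3 * M ^ 2 := by
  have hne : { s | ∃ b c, IsRun 2 n b c ∧ s = ∑ k ∈ Finset.range n, c k }.Nonempty := by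
    obtain ⟨b, c, h⟩ := exists_isRun_two n
    exact ⟨_, b, c, h, rfl⟩
  obtain ⟨b, c, h, hs⟩ := Nat.sInf_mem hne
  rw [shuffleCost, hs]
  exact h.mul_le_cost M

/-- With two bins, the optimal ball-shuffling cost satisfies
f_2(n) ≥ (1/4)·n^{4/3} − 2n for every n ≥ 1. -/
theorem shuffleCost_two_bins_lower_bound (n : ℕ) (hn : 1 ≤ n) :
    (shuffleCost 2 n : ℝ) ≥ (1 / 4 : ℝ) * (n : ℝ) ^ ((4 : ℝ) / 3) - 2 * (n : ℝ) := by
  have hn0 : (0 : ℝ) < n := by exact_mod_cast hn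
  set r : ℝ := (n : ℝ) ^ ((1 : ℝ) / 3) with hr
  have hr0 : 0 ≤ r := by positivity
  have hr3 : r ^ 3 = n := by
    rw [hr, ← Real.rpow_natCast, ← Real.rpow_mul hn0.le]; norm_num
  have hpow : (n : ℝ) ^ ((4 : ℝ) / 3) = n * r := by
    rw [show (4 : ℝ) / 3 = 1 + 1 / 3 by norm_num, Real.rpow_add hn0, Real.rpow_one]
  rw [hpow]
  have hcost : (0 : ℝ) ≤ shuffleCost 2 n := Nat.cast_nonneg _
  rcases le_or_gt r 8 with h8 | h8
  · nlinarith
  · have hmain : (n : ℝ) * ⌊r⌋₊ ≤ shuffleCost 2 n + (⌊r⌋₊ : ℝ) ^ 3 + 3 * (⌊r⌋₊ : ℝ) ^ 2 := by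
      exact_mod_cast mul_le_shuffleCost_two n ⌊r⌋₊
    have hle : (⌊r⌋₊ : ℝ) ≤ r := Nat.floor_le hr0
    have hlt : r < ⌊r⌋₊ + 1 := Nat.lt_floor_add_one r
    have h3 : (⌊r⌋₊ : ℝ) ^ 3 ≤ n := hr3 ▸ pow_le_pow_left₀ (Nat.cast_nonneg _) hle 3
    have h2 : (⌊r⌋₊ : ℝ) ^ 2 ≤ r ^ 2 := pow_le_pow_left₀ (Nat.cast_nonneg _) hle 2
    have hr2 : r ^ 2 ≤ n := hr3 ▸ pow_le_pow_right₀ (by linarith) (by norm_num)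
    nlinarith [mul_le_mul_of_nonneg_left hlt.le hn0.le, mul_le_mul_of_nonneg_left h8.le hn0.le]
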